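/- arXiv:2010.15659 — 3 statements merged into one kernel-verified Lean document; each statement's English description precedes it below -/
import Mathlib

section
/- Let n, k be positive integers, let Σ ∈ ℝ^{n×n} be symmetric positive semidefinite, let η ∈ ℝ^n satisfy η^TΣη > 0, let A ∈ ℝ^{k×n} and b ∈ ℝ^k. Set C = (η^TΣη)^{-1}Ση, and for y ∈ ℝ^n set z = (Id − Cη^T)y. Then for every y ∈ ℝ^n, the inequality Ay ≤ b (componentwise) holds if and only if the following three conditions hold: (i) V^−(z) ≤ η^Ty, (ii) η^Ty ≤ V^+(z), and (iii) (Az)_j ≤ b_j for every index j with (AC)_j = 0. -/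
open Matrix

/-- Lower truncation point `V⁻(z)`: the maximum of `(b j - (Az) j) / (AC) j` over indices `j`
with `(AC) j < 0`, with the convention `V⁻(z) = -∞` when the index set is empty. -/
noncomputable def Vminus {k n : ℕ} (A : Matrix (Fin k) (Fin n) ℝ) (b : Fin k → ℝ)
    (C z : Fin n → ℝ) : EReal :=
  ⨆ j : {j : Fin k // A.mulVec C j < 0},
    (((b j.1 - A.mulVec z j.1) / A.mulVec C j.1 : ℝ) : EReal)

/-- Upper truncation point `V⁺(z)`: the minimum of `(b j - (Az) j) / (AC) j` over indices `j`
with `(AC) j > 0`, with the convention `V⁺(z) = +∞` when the index set is empty. -/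
noncomputable def Vplus {k n : ℕ} (A : Matrix (Fin k) (Fin n) ℝ) (b : Fin k → ℝ)
    (C z : Fin n → ℝ) : EReal :=
  ⨅ j : {j : Fin k // 0 < A.mulVec C j},
    (((b j.1 - A.mulVec z j.1) / A.mulVec C j.1 : ℝ) : EReal)

theorem Vminus_le_coe_iff {k n : ℕ} (A : Matrix (Fin k) (Fin n) ℝ) (b : Fin k → ℝ)
    (C z : Fin n → ℝ) (t : ℝ) :
    Vminus A b C z ≤ (t : EReal) ↔
      ∀ j, A.mulVec C j < 0 → A.mulVec z j + A.mulVec C j * t ≤ b j := by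
  simp only [Vminus, iSup_le_iff, Subtype.forall, EReal.coe_le_coe_iff]
  refine forall₂_congr fun j hj => ?_
  rw [div_le_iff_of_neg hj, mul_comm t, le_sub_iff_add_le']

theorem coe_le_Vplus_iff {k n : ℕ} (A : Matrix (Fin k) (Fin n) ℝ) (b : Fin k → ℝ)
    (C z : Fin n → ℝ) (t : ℝ) :
    (t : EReal) ≤ Vplus A b C z ↔
      ∀ j, 0 < A.mulVec C j → A.mulVec z j + A.mulVec C j * t ≤ b j := by
  simp only [Vplus, le_iInf_iff, Subtype.forall, EReal.coe_le_coe_iff]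
  refine forall₂_congr fun j hj => ?_
  rw [le_div_iff₀ hj, mul_comm t, le_sub_iff_add_le']

/-- **Polyhedral lemma (deterministic form).** For `C = (ηᵀΣη)⁻¹ Ση` and
`z = (Id - Cηᵀ) y`, the componentwise inequality `A y ≤ b` holds iff
`V⁻(z) ≤ ηᵀy`, `ηᵀy ≤ V⁺(z)`, and `(Az)ⱼ ≤ bⱼ` for all `j` with `(AC)ⱼ = 0`. -/
theorem polyhedral_lemma_deterministic {n k : ℕ} (hn : 0 < n) (hk : 0 < k)
    (Cov : Matrix (Fin n) (Fin n) ℝ) (hCov : Cov.PosSemidef)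
    (η : Fin n → ℝ) (hη : 0 < η ⬝ᵥ Cov.mulVec η)
    (A : Matrix (Fin k) (Fin n) ℝ) (b : Fin k → ℝ)
    (C : Fin n → ℝ) (hC : C = (η ⬝ᵥ Cov.mulVec η)⁻¹ • Cov.mulVec η)
    (y : Fin n → ℝ)
    (z : Fin n → ℝ) (hz : z = fun i => y i - C i * (η ⬝ᵥ y)) :
    (∀ j, A.mulVec y j ≤ b j) ↔
      (Vminus A b C z ≤ ((η ⬝ᵥ y : ℝ) : EReal) ∧
        ((η ⬝ᵥ y : ℝ) : EReal) ≤ Vplus A b C z ∧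
        ∀ j, A.mulVec C j = 0 → A.mulVec z j ≤ b j) := by
  have hy : ∀ j, A.mulVec y j = A.mulVec z j + A.mulVec C j * (η ⬝ᵥ y) := by
    have hyz : y = z + (η ⬝ᵥ y) • C := by
      ext i
      simp [hz, mul_comm]
    intro j
    conv_lhs => rw [hyz, mulVec_add, mulVec_smul]
    simp [mul_comm]
  rw [Vminus_le_coe_iff, coe_le_Vplus_iff]
  simp only [hy]
  constructor
  · intro h
    exact ⟨fun j _ => h j, fun j _ => h j, fun j hj => by simpa [hj] using h j⟩
  · rintro ⟨hneg, hpos, hzero⟩ j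
    rcases lt_trichotomy (A.mulVec C j) 0 with hj | hj | hj
    · exact hneg j hj
    · simpa [hj] using hzero j hj
    · exact hpos j hj
end

section
/- Let H ∈ ℝ^p, let M ∈ ℝ^{p×p} be symmetric positive definite, let λ > 0 and let w ∈ ℝ^p have nonnegative entries. Let β̂ be the unique minimizer over the nonnegative orthant ℝ^p_+ of f(β) = −β^T H + (1/2) β^T M β + λ β^T w, and let Ŝ = {s : β̂_s > 0}. Then for any subset S ⊆ {1,…,p}, the equality Ŝ = S holds if and only if both of the following componentwise conditions hold: (i) M_{SS}^{-1}(H_S − λ w_S) > 0, and (ii) H_{S^c} − M_{S^cS} M_{SS}^{-1}(H_S − λ w_S) ≤ λ w_{S^c}. In particular, for fixed S, M, λ and w, the event {Ŝ = S} is described by a finite system of affine inequalities in H. -/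
open Matrix

/-- The normal weighted HSIC-Lasso objective
`f(β) = -βᵀH + (1/2) βᵀMβ + λ βᵀw`. -/
noncomputable def hsicLassoObj {p : ℕ} (H : Fin p → ℝ) (M : Matrix (Fin p) (Fin p) ℝ)
    (lam : ℝ) (w : Fin p → ℝ) (β : Fin p → ℝ) : ℝ :=
  -(β ⬝ᵥ H) + (1 / 2) * (β ⬝ᵥ M.mulVec β) + lam * (β ⬝ᵥ w)

/-- The gradient at `β` of the HSIC-Lasso objective. -/
def hsicLassoGrad {p : ℕ} (H : Fin p → ℝ) (M : Matrix (Fin p) (Fin p) ℝ)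
    (lam : ℝ) (w : Fin p → ℝ) (β : Fin p → ℝ) : Fin p → ℝ :=
  M *ᵥ β - H + lam • w

theorem hsicLassoObj_add_single {p : ℕ} (H : Fin p → ℝ) {M : Matrix (Fin p) (Fin p) ℝ}
    (hM : M.IsSymm) (lam : ℝ) (w β : Fin p → ℝ) (i : Fin p) (t : ℝ) :
    hsicLassoObj H M lam w (β + Pi.single i t) =
      hsicLassoObj H M lam w β + t * hsicLassoGrad H M lam w β i + t ^ 2 / 2 * M i i := by
  have h : β ⬝ᵥ M *ᵥ Pi.single i t = t * (M *ᵥ β) i := by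
    rw [dotProduct_mulVec, ← mulVec_transpose, hM.eq, dotProduct_single, mul_comm]
  have h' : (M *ᵥ Pi.single i t) i = M i i * t := by simp [mulVec, dotProduct_single]
  simp only [hsicLassoObj, hsicLassoGrad, mulVec_add, add_dotProduct, dotProduct_add, h,
    single_dotProduct, h', Pi.add_apply, Pi.sub_apply, Pi.smul_apply, smul_eq_mul]
  ring

/-- If the quadratic `t ↦ t * g + t ^ 2 / 2 * m` is nonnegative on `[-b, ∞)`, then its slope at the
origin is nonnegative, and vanishes when the origin is interior. -/
theorem slope_nonneg_of_quadratic_nonneg {g m b : ℝ} (hm : 0 < m) (hb : 0 ≤ b)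
    (h : ∀ t, -b ≤ t → 0 ≤ t * g + t ^ 2 / 2 * m) : 0 ≤ g ∧ (0 < b → g = 0) := by
  have hg : 0 ≤ g := by
    by_contra! hg
    have hpos : 0 < -g / m := div_pos (neg_pos.2 hg) hm
    have := h (-g / m) (by linarith)
    have hmul : -g / m * m = -g := div_mul_cancel₀ _ hm.ne'
    nlinarith
  refine ⟨hg, fun hb' => ?_⟩
  by_contra hne
  have hg' : 0 < g := lt_of_le_of_ne hg (Ne.symm hne)
  set s := min b (g / m)
  have hs : 0 < s := lt_min hb' (div_pos hg' hm)
  have hsm : s * m ≤ g := (le_div_iff₀ hm).1 (min_le_right _ _)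
  have := h (-s) (neg_le_neg (min_le_left _ _))
  nlinarith

/-- The Karush–Kuhn–Tucker conditions at a minimizer over the nonnegative orthant. -/
theorem hsicLassoGrad_of_isMin {p : ℕ} {H : Fin p → ℝ} {M : Matrix (Fin p) (Fin p) ℝ}
    (hM : M.PosDef) {lam : ℝ} {w β : Fin p → ℝ} (hβ : ∀ i, 0 ≤ β i)
    (hmin : ∀ γ : Fin p → ℝ, (∀ i, 0 ≤ γ i) →
      hsicLassoObj H M lam w β ≤ hsicLassoObj H M lam w γ) (i : Fin p) :
    0 ≤ hsicLassoGrad H M lam w β i ∧ (0 < β i → hsicLassoGrad H M lam w β i = 0) := by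
  have hsymm : M.IsSymm := isHermitian_iff_isSymm.1 hM.isHermitian
  refine slope_nonneg_of_quadratic_nonneg (hM.diag_pos (i := i)) (hβ i) fun t ht => ?_
  have := hmin (β + Pi.single i t) fun j => by
    rcases eq_or_ne j i with rfl | hj
    · simpa using neg_le_iff_add_nonneg'.1 ht
    · simpa [hj] using hβ j
  rw [hsicLassoObj_add_single H hsymm] at this
  linarith

/-- Two nonnegative points satisfying the Karush–Kuhn–Tucker conditions coincide. -/
theorem eq_of_hsicLassoGrad {p : ℕ} {H : Fin p → ℝ} {M : Matrix (Fin p) (Fin p) ℝ}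
    (hM : M.PosDef) {lam : ℝ} {w β γ : Fin p → ℝ} (hβ : ∀ i, 0 ≤ β i) (hγ : ∀ i, 0 ≤ γ i)
    (hgβ : ∀ i, 0 ≤ hsicLassoGrad H M lam w β i ∧ (0 < β i → hsicLassoGrad H M lam w β i = 0))
    (hgγ : ∀ i, 0 ≤ hsicLassoGrad H M lam w γ i ∧ (0 < γ i → hsicLassoGrad H M lam w γ i = 0)) :
    β = γ := by
  by_contra hne
  have hpos := hM.dotProduct_mulVec_pos (sub_ne_zero.2 hne)
  have hgrad : M *ᵥ (β - γ) = hsicLassoGrad H M lam w β - hsicLassoGrad H M lam w γ := by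
    simp only [hsicLassoGrad, mulVec_sub]
    abel
  rw [star_trivial, hgrad] at hpos
  refine hpos.not_ge (Finset.sum_nonpos fun i _ => ?_)
  simp only [Pi.sub_apply]
  obtain ⟨hβ0, hβ1⟩ := hgβ i
  obtain ⟨hγ0, hγ1⟩ := hgγ i
  have hcβ : β i * hsicLassoGrad H M lam w β i = 0 := by
    rcases (hβ i).eq_or_lt with h | h
    · simp [← h]
    · simp [hβ1 h]
  have hcγ : γ i * hsicLassoGrad H M lam w γ i = 0 := by
    rcases (hγ i).eq_or_lt with h | h
    · simp [← h]
    · simp [hγ1 h]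
  nlinarith [mul_nonneg (hβ i) hγ0, mul_nonneg (hγ i) hβ0]

theorem mulVec_apply_eq_sum_subtype {n R : Type*} [Fintype n] [NonUnitalNonAssocSemiring R]
    (M : Matrix n n R) {S : Finset n} {x : n → R} (hx : ∀ i, i ∉ S → x i = 0) (j : n) :
    (M *ᵥ x) j = ∑ i : {i // i ∈ S}, M j i.1 * x i.1 := by
  rw [Finset.sum_coe_sort S fun i => M j i * x i]
  exact (Finset.sum_subset S.subset_univ fun i _ hi => by simp [hx i hi]).symm

/-- **Characterisation of the HSIC-Lasso selection event `{Ŝ = S}`.**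
With `v = M_{SS}⁻¹ (H_S - λ w_S)`, the selected set `Ŝ = {s : β̂ s > 0}` equals `S` iff
(i) `v > 0` componentwise, and (ii) `H_{Sᶜ} - M_{SᶜS} v ≤ λ w_{Sᶜ}` componentwise. -/
theorem hsicLasso_selection_event {p : ℕ} (H : Fin p → ℝ)
    (M : Matrix (Fin p) (Fin p) ℝ) (hM : M.PosDef)
    (lam : ℝ) (hlam : 0 < lam) (w : Fin p → ℝ) (hw : ∀ i, 0 ≤ w i)
    (βh : Fin p → ℝ) (hβh : ∀ i, 0 ≤ βh i)
    (hmin : ∀ β : Fin p → ℝ, (∀ i, 0 ≤ β i) →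
      hsicLassoObj H M lam w βh ≤ hsicLassoObj H M lam w β)
    (S : Finset (Fin p))
    (v : {i // i ∈ S} → ℝ)
    (hv : v = (M.submatrix (fun i : {i // i ∈ S} => i.1) (fun i : {i // i ∈ S} => i.1))⁻¹.mulVec
      (fun i : {i // i ∈ S} => H i.1 - lam * w i.1)) :
    {s : Fin p | 0 < βh s} = ↑S ↔
      ((∀ i : {i // i ∈ S}, 0 < v i) ∧
        ∀ j : Fin p, j ∉ S → H j - ∑ i : {i // i ∈ S}, M j i.1 * v i ≤ lam * w j) := by
  have hdet : IsUnit (M.submatrix (fun i : {i // i ∈ S} => i.1)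
      (fun i : {i // i ∈ S} => i.1)).det :=
    ((hM.submatrix Subtype.val_injective).det_pos).ne'.isUnit
  have hkkt := hsicLassoGrad_of_isMin hM hβh hmin
  have hgrad : ∀ {x : Fin p → ℝ}, (∀ i, i ∉ S → x i = 0) → ∀ j,
      hsicLassoGrad H M lam w x j =
        ∑ i : {i // i ∈ S}, M j i.1 * x i.1 - H j + lam * w j := fun hx j => by
    simp [hsicLassoGrad, mulVec_apply_eq_sum_subtype M hx]
  constructor
  · intro hS
    have hmem : ∀ i, 0 < βh i ↔ i ∈ S := fun i => by
      simpa using Set.ext_iff.1 hS i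
    have hzero : ∀ i, i ∉ S → βh i = 0 := fun i hi =>
      le_antisymm (not_lt.1 fun h => hi ((hmem i).1 h)) (hβh i)
    have hveq : v = fun i => βh i.1 := by
      rw [hv, eq_comm, ← one_mulVec (fun i : {i // i ∈ S} => βh i.1), ← nonsing_inv_mul _ hdet,
        ← mulVec_mulVec]
      congr 1
      ext i
      have h := (hkkt i.1).2 ((hmem i.1).2 i.2)
      rw [hgrad hzero] at h
      simp only [mulVec, dotProduct, submatrix_apply]
      linarith
    subst hveq
    refine ⟨fun i => (hmem i.1).2 i.2, fun j _ => ?_⟩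
    have h := (hkkt j).1
    rw [hgrad hzero] at h
    linarith
  · rintro ⟨hvpos, hvle⟩
    set x : Fin p → ℝ := fun i => if h : i ∈ S then v ⟨i, h⟩ else 0
    have hxv : ∀ i : {i // i ∈ S}, x i.1 = v i := fun i => by simp [x]
    have hzero : ∀ i, i ∉ S → x i = 0 := fun i hi => by simp [x, hi]
    have hxpos : ∀ i, i ∈ S → 0 < x i := fun i hi => by
      rw [hxv ⟨i, hi⟩]
      exact hvpos _
    have hxnonneg : ∀ i, 0 ≤ x i := fun i => by
      by_cases hi : i ∈ S
      · exact (hxpos i hi).le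
      · exact (hzero i hi).ge
    have hgS : ∀ i, i ∈ S → hsicLassoGrad H M lam w x i = 0 := fun i hi => by
      have h : M.submatrix (fun i : {i // i ∈ S} => i.1) (fun i : {i // i ∈ S} => i.1) *ᵥ v =
          fun i : {i // i ∈ S} => H i.1 - lam * w i.1 := by
        rw [hv, mulVec_mulVec, mul_nonsing_inv _ hdet, one_mulVec]
      have h' := congrFun h ⟨i, hi⟩
      simp only [mulVec, dotProduct, submatrix_apply] at h'
      rw [hgrad hzero]
      simp only [hxv]
      linarith
    have hβx : βh = x := by
      refine eq_of_hsicLassoGrad hM hβh hxnonneg hkkt fun i => ?_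
      by_cases hi : i ∈ S
      · exact ⟨(hgS i hi).ge, fun _ => hgS i hi⟩
      · refine ⟨?_, fun h => absurd (hzero i hi) h.ne'⟩
        rw [hgrad hzero]
        simp only [hxv]
        linarith [hvle i hi]
    ext i
    rw [Set.mem_ofPred_eq, Finset.mem_coe, hβx]
    exact ⟨fun h => by_contra fun hi => h.ne' (hzero i hi), hxpos i⟩
end

section
/- Let Y be an ℝ^n-valued Gaussian random vector with mean μ ∈ ℝ^n and positive definite covariance Σ, let η ∈ ℝ^n be nonzero, let A ∈ ℝ^{k×n} and b ∈ ℝ^k with P(AY ≤ b) > 0, set C = (η^TΣη)^{-1}Ση and Z = (Id − Cη^T)Y, and define the test statistic T₁ = 1 − F^{[V^−(Z),V^+(Z)]}_{0, η^TΣη}(η^T Y). If η^Tμ = 0, then for every α ∈ [0,1], P(T₁ ≤ α | AY ≤ b) = α; that is, T₁ is a valid p-value conditional on the selection event {AY ≤ b}. -/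
open Matrix MeasureTheory ProbabilityTheory

/-- The standard normal cumulative distribution function `Φ`. -/
noncomputable def stdNormalCDF (x : ℝ) : ℝ :=
  ((gaussianReal 0 1) (Set.Iic x)).toReal

/-- `Φ((a - μ)/σ)` for an extended-real argument `a`, with `Φ(-∞) = 0`, `Φ(+∞) = 1`. -/
noncomputable def stdNormalCDFAff (μ σ : ℝ) (a : EReal) : ℝ :=
  if a = ⊥ then 0 else if a = ⊤ then 1 else stdNormalCDF ((a.toReal - μ) / σ)

/-- The cdf of the Gaussian `N(μ, σ²)` truncated to `[a, b] ⊆ [-∞, +∞]`. -/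
noncomputable def truncGaussCDF (μ σ : ℝ) (a b : EReal) (x : ℝ) : ℝ :=
  (stdNormalCDF ((x - μ) / σ) - stdNormalCDFAff μ σ a) /
    (stdNormalCDFAff μ σ b - stdNormalCDFAff μ σ a)

/-- `Y` is a Gaussian random vector with mean `μ` and covariance `Σ` under `P`. -/
def IsGaussianVector {Ω : Type*} [MeasurableSpace Ω] (P : Measure Ω) {n : ℕ}
    (Y : Ω → Fin n → ℝ) (μ : Fin n → ℝ) (Cov : Matrix (Fin n) (Fin n) ℝ) : Prop :=
  ∀ u : Fin n → ℝ,
    P.map (fun ω => u ⬝ᵥ Y ω) = gaussianReal (u ⬝ᵥ μ) (Real.toNNReal (u ⬝ᵥ Cov.mulVec u))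

lemma stdNormalCDF_eq_cdf (x : ℝ) : stdNormalCDF x = cdf (gaussianReal 0 1) x := by
  rw [cdf_eq_real]; rfl

lemma continuous_stdNormalCDF : Continuous stdNormalCDF := by
  have h : stdNormalCDF = cdf (gaussianReal 0 1) := funext stdNormalCDF_eq_cdf
  rw [h, continuous_iff_continuousAt]
  intro x
  rw [(monotone_cdf _).continuousAt_iff_leftLim_eq_rightLim, StieltjesFunction.rightLim_eq]
  have := nullSingletonClass_gaussianReal (μ := 0) (v := 1) one_ne_zero
  have h0 := (cdf (gaussianReal 0 1)).measure_singleton x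
  rw [measure_cdf, measure_singleton, eq_comm, ENNReal.ofReal_eq_zero] at h0
  exact le_antisymm ((monotone_cdf _).leftLim_le le_rfl) (by linarith)

lemma strictMono_stdNormalCDF : StrictMono stdNormalCDF := by
  intro x y hxy
  have h0 := (cdf (gaussianReal 0 1)).measure_Ioc x y
  rw [measure_cdf] at h0
  have hpos : gaussianReal 0 1 (Set.Ioc x y) ≠ 0 := fun h => by
    have := gaussianReal_absolutelyContinuous' 0 one_ne_zero h
    simp [hxy.not_ge] at this
  rw [h0] at hpos
  rw [stdNormalCDF_eq_cdf, stdNormalCDF_eq_cdf]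
  simpa using hpos

lemma stdNormalCDF_pos (x : ℝ) : 0 < stdNormalCDF x :=
  ENNReal.toReal_nonneg.trans_lt (strictMono_stdNormalCDF (sub_one_lt x))

lemma stdNormalCDF_lt_one (x : ℝ) : stdNormalCDF x < 1 :=
  (strictMono_stdNormalCDF (lt_add_one x)).trans_le
    (by rw [stdNormalCDF_eq_cdf]; exact cdf_le_one _ _)

lemma exists_stdNormalCDF_eq {c : ℝ} (h0 : 0 < c) (h1 : c < 1) : ∃ x, stdNormalCDF x = c := by
  have h : stdNormalCDF = cdf (gaussianReal 0 1) := funext stdNormalCDF_eq_cdf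
  refine mem_range_of_exists_le_of_exists_ge continuous_stdNormalCDF ?_ ?_
  · rw [h]
    exact ((tendsto_cdf_atBot (gaussianReal 0 1)).eventually_le_const h0).exists
  · rw [h]
    exact ((tendsto_cdf_atTop (gaussianReal 0 1)).eventually_const_le h1).exists

/-- Probability integral transform for the standard normal distribution. -/
lemma map_stdNormalCDF_gaussianReal :
    (gaussianReal 0 1).map stdNormalCDF = volume.restrict (Set.Icc 0 1) := by
  have hm := continuous_stdNormalCDF.measurable
  have := Measure.isProbabilityMeasure_map (μ := gaussianReal 0 1) hm.aemeasurable
  refine Measure.ext_of_Iic _ _ fun c => ?_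
  rw [Measure.map_apply hm measurableSet_Iic, Measure.restrict_apply measurableSet_Iic]
  rcases le_or_gt c 0 with h0 | h0
  · have h1 : stdNormalCDF ⁻¹' Set.Iic c = ∅ := by
      ext x
      simpa using h0.trans_lt (stdNormalCDF_pos x)
    have h2 : Set.Iic c ∩ Set.Icc 0 1 ⊆ {0} := fun x hx => le_antisymm (hx.1.trans h0) hx.2.1
    rw [h1, measure_empty, measure_mono_null h2 (by simp)]
  rcases le_or_gt 1 c with h1 | h1
  · have h2 : stdNormalCDF ⁻¹' Set.Iic c = Set.univ := by
      ext x
      simpa using (stdNormalCDF_lt_one x).le.trans h1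
    have h3 : Set.Iic c ∩ Set.Icc 0 1 = Set.Icc 0 1 :=
      Set.inter_eq_right.2 fun x hx => hx.2.trans h1
    rw [h2, h3]
    simp
  obtain ⟨x, rfl⟩ := exists_stdNormalCDF_eq h0 h1
  have h2 : stdNormalCDF ⁻¹' Set.Iic (stdNormalCDF x) = Set.Iic x := by
    ext y
    simp [strictMono_stdNormalCDF.le_iff_le]
  have h3 : Set.Iic (stdNormalCDF x) ∩ Set.Icc 0 1 = Set.Icc 0 (stdNormalCDF x) := by
    ext y
    simp only [Set.mem_inter_iff, Set.mem_Iic, Set.mem_Icc]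
    constructor
    · rintro ⟨h, h', -⟩
      exact ⟨h', h⟩
    · rintro ⟨h, h'⟩
      exact ⟨h', h, h'.trans h1.le⟩
  rw [h2, h3, Real.volume_Icc, sub_zero, stdNormalCDF, ENNReal.ofReal_toReal (measure_ne_top _ _)]

lemma gaussianReal_stdNormalCDF_div_mem_Icc {v : ℝ} (hv : 0 < v) {c d : ℝ} (hc : 0 ≤ c)
    (hd : d ≤ 1) :
    gaussianReal 0 v.toNNReal {x | c ≤ stdNormalCDF (x / √v) ∧ stdNormalCDF (x / √v) ≤ d} =
      ENNReal.ofReal (d - c) := by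
  have hm := continuous_stdNormalCDF.measurable
  have hmap : (gaussianReal 0 v.toNNReal).map (· / √v) = gaussianReal 0 1 := by
    rw [gaussianReal_map_div_const, zero_div]
    congr 1
    ext
    simp [Real.sq_sqrt hv.le, hv.le, hv.ne']
  have h : gaussianReal 0 v.toNNReal ((· / √v) ⁻¹' (stdNormalCDF ⁻¹' Set.Icc c d)) =
      ENNReal.ofReal (d - c) := by
    rw [← Measure.map_apply (by fun_prop) (hm measurableSet_Icc), hmap,
      ← Measure.map_apply hm measurableSet_Icc, map_stdNormalCDF_gaussianReal,
      Measure.restrict_apply measurableSet_Icc,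
      Set.inter_eq_left.2 (Set.Icc_subset_Icc hc hd), Real.volume_Icc]
  exact h

lemma stdNormalCDFAff_nonneg (μ σ : ℝ) (a : EReal) : 0 ≤ stdNormalCDFAff μ σ a := by
  unfold stdNormalCDFAff
  split_ifs
  exacts [le_rfl, zero_le_one, (stdNormalCDF_pos _).le]

lemma stdNormalCDFAff_le_one (μ σ : ℝ) (a : EReal) : stdNormalCDFAff μ σ a ≤ 1 := by
  unfold stdNormalCDFAff
  split_ifs
  exacts [zero_le_one, le_rfl, (stdNormalCDF_lt_one _).le]

lemma le_coe_iff_stdNormalCDFAff_le {σ : ℝ} (hσ : 0 < σ) (a : EReal) (x : ℝ) :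
    a ≤ x ↔ stdNormalCDFAff 0 σ a ≤ stdNormalCDF (x / σ) := by
  induction a with
  | bot => simp [stdNormalCDFAff, (stdNormalCDF_pos _).le]
  | top => simp [stdNormalCDFAff, stdNormalCDF_lt_one]
  | coe a =>
    simp [stdNormalCDFAff, strictMono_stdNormalCDF.le_iff_le, div_le_div_iff_of_pos_right hσ]

lemma coe_le_iff_le_stdNormalCDFAff {σ : ℝ} (hσ : 0 < σ) (a : EReal) (x : ℝ) :
    x ≤ a ↔ stdNormalCDF (x / σ) ≤ stdNormalCDFAff 0 σ a := by
  induction a with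
  | bot => simp [stdNormalCDFAff, stdNormalCDF_pos]
  | top => simp [stdNormalCDFAff, (stdNormalCDF_lt_one _).le]
  | coe a =>
    simp [stdNormalCDFAff, strictMono_stdNormalCDF.le_iff_le, div_le_div_iff_of_pos_right hσ]

lemma measurable_stdNormalCDFAff (μ σ : ℝ) : Measurable (stdNormalCDFAff μ σ) := by
  have := continuous_stdNormalCDF.measurable
  unfold stdNormalCDFAff
  refine Measurable.ite (measurableSet_singleton _) measurable_const
    (Measurable.ite (measurableSet_singleton _) measurable_const ?_)
  exact this.comp ((measurable_ereal_toReal.sub_const _).div_const _)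

/-- Conditionally on lying in `[lo, hi]`, one minus the truncated Gaussian cdf evaluated at a
centred Gaussian is uniformly distributed on `[0, 1]`. -/
lemma gaussianReal_one_sub_truncGaussCDF_le {v : ℝ} (hv : 0 < v) (lo hi : EReal) {α : ℝ}
    (hα : α ∈ Set.Icc (0 : ℝ) 1) :
    gaussianReal 0 v.toNNReal
        {x | (lo ≤ x ∧ x ≤ hi) ∧ 1 - truncGaussCDF 0 (√v) lo hi x ≤ α} =
      ENNReal.ofReal α * gaussianReal 0 v.toNNReal {x | lo ≤ x ∧ x ≤ hi} := by
  have hσ : 0 < √v := Real.sqrt_pos.2 hv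
  simp only [le_coe_iff_stdNormalCDFAff_le hσ, coe_le_iff_le_stdNormalCDFAff hσ, truncGaussCDF,
    sub_zero]
  have hp := stdNormalCDFAff_nonneg 0 (√v) lo
  have hq := stdNormalCDFAff_le_one 0 (√v) hi
  generalize stdNormalCDFAff 0 (√v) lo = p at *
  generalize stdNormalCDFAff 0 (√v) hi = q at *
  rw [gaussianReal_stdNormalCDF_div_mem_Icc hv hp hq]
  rcases le_or_gt q p with h | h
  · rw [ENNReal.ofReal_of_nonpos (sub_nonpos.2 h), mul_zero]
    refine measure_mono_null
      (t := {x | p ≤ stdNormalCDF (x / √v) ∧ stdNormalCDF (x / √v) ≤ q}) (fun x hx => hx.1) ?_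
    rw [gaussianReal_stdNormalCDF_div_mem_Icc hv hp hq, ENNReal.ofReal_of_nonpos (sub_nonpos.2 h)]
  · have hpq : 0 < q - p := sub_pos.2 h
    have hset : {x : ℝ | (p ≤ stdNormalCDF (x / √v) ∧ stdNormalCDF (x / √v) ≤ q) ∧
        1 - (stdNormalCDF (x / √v) - p) / (q - p) ≤ α} =
        {x | q - α * (q - p) ≤ stdNormalCDF (x / √v) ∧ stdNormalCDF (x / √v) ≤ q} := by
      ext x
      simp only [Set.mem_ofPred_eq]
      rw [sub_le_comm, le_div_iff₀ hpq]
      constructor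
      · rintro ⟨⟨h1, h2⟩, h3⟩
        exact ⟨by linarith, h2⟩
      · rintro ⟨h1, h2⟩
        exact ⟨⟨by nlinarith [hα.2], h2⟩, by linarith⟩
    rw [hset, gaussianReal_stdNormalCDF_div_mem_Icc hv (by nlinarith [hα.2]) hq,
      ← ENNReal.ofReal_mul hα.1]
    congr 1
    ring

section Truncation

variable {k n : ℕ} (A : Matrix (Fin k) (Fin n) ℝ) (b : Fin k → ℝ) (C : Fin n → ℝ)

lemma measurable_mulVec_apply (j : Fin k) : Measurable fun z : Fin n → ℝ => A.mulVec z j := by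
  simp only [mulVec, dotProduct]
  fun_prop

lemma measurable_Vminus : Measurable (Vminus A b C) := by
  unfold Vminus
  refine Measurable.iSup fun j => measurable_coe_real_ereal.comp ?_
  exact ((measurable_mulVec_apply A j).const_sub _).div_const _

lemma measurable_Vplus : Measurable (Vplus A b C) := by
  unfold Vplus
  refine Measurable.iInf fun j => measurable_coe_real_ereal.comp ?_
  exact ((measurable_mulVec_apply A j).const_sub _).div_const _

/-- On the line `z + ℝ C`, a system of affine inequalities amounts to truncation to the interval
`[V⁻(z), V⁺(z)]`. -/
lemma mulVec_add_smul_le_iff (z : Fin n → ℝ) (x : ℝ) :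
    (∀ j, A.mulVec (z + x • C) j ≤ b j) ↔
      (∀ j, A.mulVec C j = 0 → A.mulVec z j ≤ b j) ∧
        Vminus A b C z ≤ x ∧ (x : EReal) ≤ Vplus A b C z := by
  simp only [Vminus, Vplus, iSup_le_iff, le_iInf_iff, Subtype.forall, EReal.coe_le_coe_iff,
    mulVec_add, mulVec_smul, Pi.add_apply, Pi.smul_apply, smul_eq_mul]
  constructor
  · refine fun h => ⟨fun j hj => ?_, fun j hj => ?_, fun j hj => ?_⟩
    · simpa [hj] using h j
    · rw [div_le_iff_of_neg hj]
      linarith [h j]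
    · rw [le_div_iff₀ hj]
      linarith [h j]
  · rintro ⟨h0, h1, h2⟩ j
    rcases lt_trichotomy (A.mulVec C j) 0 with hj | hj | hj
    · have := h1 j hj
      rw [div_le_iff_of_neg hj] at this
      linarith
    · simpa [hj] using h0 j hj
    · have := h2 j hj
      rw [le_div_iff₀ hj] at this
      linarith

end Truncation

section GaussianVector

variable {Ω : Type*} [MeasurableSpace Ω] {P : Measure Ω} {n : ℕ} {Y : Ω → Fin n → ℝ}
  {μ : Fin n → ℝ} {Cov : Matrix (Fin n) (Fin n) ℝ}

lemma exists_dotProduct_eq (L : StrongDual ℝ (Fin n → ℝ)) :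
    ∃ u : Fin n → ℝ, ∀ y, L y = u ⬝ᵥ y := by
  refine ⟨fun i => L (Pi.single i 1), fun y => ?_⟩
  conv_lhs => rw [pi_eq_sum_univ' y]
  simp [dotProduct, mul_comm]

/-- The linear functional `y ↦ u ⬝ᵥ y` as a continuous linear map. -/
noncomputable def dotProductCLM (u : Fin n → ℝ) : (Fin n → ℝ) →L[ℝ] ℝ :=
  LinearMap.toContinuousLinearMap (dotProductBilin ℝ ℝ u)

lemma measurable_dotProduct_left (u : Fin n → ℝ) : Measurable fun y : Fin n → ℝ => u ⬝ᵥ y :=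
  (dotProductCLM u).continuous.measurable

lemma IsGaussianVector.hasGaussianLaw (hY : IsGaussianVector P Y μ Cov) (hYm : Measurable Y) :
    HasGaussianLaw Y P where
  isGaussian_map := by
    refine isGaussian_of_map_eq_gaussianReal fun L => ?_
    obtain ⟨u, hu⟩ := exists_dotProduct_eq L
    refine ⟨u ⬝ᵥ μ, (u ⬝ᵥ Cov.mulVec u).toNNReal, ?_⟩
    rw [Measure.map_map L.continuous.measurable hYm, ← hY u]
    congr 1
    ext ω
    exact hu _

lemma IsGaussianVector.variance_dotProduct (hY : IsGaussianVector P Y μ Cov) (hYm : Measurable Y)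
    (hCov : Cov.PosSemidef) (u : Fin n → ℝ) :
    Var[fun ω => u ⬝ᵥ Y ω; P] = u ⬝ᵥ Cov.mulVec u := by
  have hm : Measurable fun ω => u ⬝ᵥ Y ω := (measurable_dotProduct_left u).comp hYm
  rw [← variance_id_map hm.aemeasurable, hY u, variance_id_gaussianReal, Real.coe_toNNReal]
  simpa using hCov.dotProduct_mulVec_nonneg u

lemma IsGaussianVector.covariance_dotProduct [IsFiniteMeasure P]
    (hY : IsGaussianVector P Y μ Cov) (hYm : Measurable Y)
    (hCov : Cov.PosSemidef) (u w : Fin n → ℝ) :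
    cov[fun ω => u ⬝ᵥ Y ω, fun ω => w ⬝ᵥ Y ω; P] = w ⬝ᵥ Cov.mulVec u := by
  have hL (u : Fin n → ℝ) : MemLp (fun ω => u ⬝ᵥ Y ω) 2 P :=
    ((hY.hasGaussianLaw hYm).map_fun (dotProductCLM u)).memLp_two
  have h := variance_fun_add (hL u) (hL w)
  simp only [← add_dotProduct, hY.variance_dotProduct hYm hCov, mulVec_add, dotProduct_add] at h
  have hsymm : u ⬝ᵥ Cov.mulVec w = w ⬝ᵥ Cov.mulVec u := by
    have hT : Covᵀ = Cov := by
      simpa only [conjTranspose_eq_transpose_of_trivial] using hCov.isHermitian.eq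
    rw [dotProduct_mulVec, ← mulVec_transpose, hT, dotProduct_comm]
  simp only [add_dotProduct] at h
  linarith

/-- The coordinate `ηᵀY` is independent of the residual `Y - C ηᵀY`. -/
lemma IsGaussianVector.indepFun_residual [IsFiniteMeasure P]
    (hY : IsGaussianVector P Y μ Cov) (hYm : Measurable Y) (hCov : Cov.PosSemidef)
    {η : Fin n → ℝ} (hη : η ⬝ᵥ Cov.mulVec η ≠ 0) :
    IndepFun (fun ω => η ⬝ᵥ Y ω)
      (fun ω => Y ω - (η ⬝ᵥ Y ω) • ((η ⬝ᵥ Cov.mulVec η)⁻¹ • Cov.mulVec η)) P := by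
  set C := (η ⬝ᵥ Cov.mulVec η)⁻¹ • Cov.mulVec η with hC
  refine HasGaussianLaw.indepFun_of_covariance_strongDual
    ((hY.hasGaussianLaw hYm).map_fun ((dotProductCLM η).prod
      (ContinuousLinearMap.id ℝ _ - (dotProductCLM η).smulRight C))) fun L₁ L₂ => ?_
  obtain ⟨u, hu⟩ := exists_dotProduct_eq L₂
  have h1 : L₁ ∘ (fun ω => η ⬝ᵥ Y ω) = fun ω => (L₁ 1 • η) ⬝ᵥ Y ω := by
    ext ω
    have := L₁.map_smul (η ⬝ᵥ Y ω) 1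
    simp only [smul_eq_mul, mul_one] at this
    simp [this, mul_comm]
  have h2 : L₂ ∘ (fun ω => Y ω - (η ⬝ᵥ Y ω) • C) = fun ω => (u - (u ⬝ᵥ C) • η) ⬝ᵥ Y ω := by
    ext ω
    simp [hu, dotProduct_sub, sub_dotProduct, mul_comm]
  rw [h1, h2, hY.covariance_dotProduct hYm hCov, hC]
  simp only [mulVec_smul, dotProduct_smul, sub_dotProduct, smul_dotProduct, smul_eq_mul]
  field_simp
  ring

end GaussianVector

/-- **Validity of the one-sided selective p-value.** Under the null hypothesis
`ηᵀμ = 0`, the statistic `T₁ = 1 - F^{[V⁻(Z), V⁺(Z)]}_{0, ηᵀΣη}(ηᵀY)` satisfies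
`P(T₁ ≤ α | AY ≤ b) = α` for every `α ∈ [0,1]`. -/
theorem selective_p_value_valid {Ω : Type*} [MeasurableSpace Ω] (P : Measure Ω)
    [IsProbabilityMeasure P] {n k : ℕ}
    (Y : Ω → Fin n → ℝ) (hYm : Measurable Y)
    (μ : Fin n → ℝ) (Cov : Matrix (Fin n) (Fin n) ℝ) (hCov : Cov.PosDef)
    (hY : IsGaussianVector P Y μ Cov)
    (η : Fin n → ℝ) (hη : η ≠ 0)
    (A : Matrix (Fin k) (Fin n) ℝ) (b : Fin k → ℝ)
    (hsel : 0 < P {ω | ∀ j, A.mulVec (Y ω) j ≤ b j})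
    (C : Fin n → ℝ) (hC : C = (η ⬝ᵥ Cov.mulVec η)⁻¹ • Cov.mulVec η)
    (Z : Ω → Fin n → ℝ) (hZ : ∀ ω, Z ω = fun i => Y ω i - C i * (η ⬝ᵥ Y ω))
    (T : Ω → ℝ)
    (hT : ∀ ω, T ω = 1 - truncGaussCDF 0 (Real.sqrt (η ⬝ᵥ Cov.mulVec η))
      (Vminus A b C (Z ω)) (Vplus A b C (Z ω)) (η ⬝ᵥ Y ω))
    (hnull : η ⬝ᵥ μ = 0) :
    ∀ α ∈ Set.Icc (0 : ℝ) 1,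
      (P[|{ω | ∀ j, A.mulVec (Y ω) j ≤ b j}]) {ω | T ω ≤ α} = ENNReal.ofReal α := by
  intro α hα
  have hv : 0 < η ⬝ᵥ Cov.mulVec η := by simpa using hCov.dotProduct_mulVec_pos hη
  set v := η ⬝ᵥ Cov.mulVec η
  have hZ' : Z = fun ω => Y ω - (η ⬝ᵥ Y ω) • C := by
    ext ω i
    simp [hZ, mul_comm]
  have hXm : Measurable fun ω => η ⬝ᵥ Y ω := (measurable_dotProduct_left η).comp hYm
  have hZm : Measurable Z := by
    rw [hZ']
    exact hYm.sub (hXm.smul_const C)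
  have hjoint : P.map (fun ω => (η ⬝ᵥ Y ω, Z ω)) = (gaussianReal 0 v.toNNReal).prod (P.map Z) := by
    have hind : IndepFun (fun ω => η ⬝ᵥ Y ω) Z P := by
      rw [hZ', hC]
      exact hY.indepFun_residual hYm hCov.posSemidef hv.ne'
    rw [(indepFun_iff_map_prod_eq_prod_map_map hXm.aemeasurable hZm.aemeasurable).1 hind, hY η,
      hnull]
  let S : Set (ℝ × (Fin n → ℝ)) := {p | (∀ j, A.mulVec C j = 0 → A.mulVec p.2 j ≤ b j) ∧
    Vminus A b C p.2 ≤ p.1 ∧ (p.1 : EReal) ≤ Vplus A b C p.2}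
  let R : Set (ℝ × (Fin n → ℝ)) :=
    {p | 1 - truncGaussCDF 0 (√v) (Vminus A b C p.2) (Vplus A b C p.2) p.1 ≤ α}
  have hVm : Measurable fun p : ℝ × (Fin n → ℝ) => Vminus A b C p.2 :=
    (measurable_Vminus A b C).comp measurable_snd
  have hVp : Measurable fun p : ℝ × (Fin n → ℝ) => Vplus A b C p.2 :=
    (measurable_Vplus A b C).comp measurable_snd
  have hcoe : Measurable fun p : ℝ × (Fin n → ℝ) => (p.1 : EReal) :=
    measurable_coe_real_ereal.comp measurable_fst
  have hS : MeasurableSet S := by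
    have h0 : MeasurableSet {p : ℝ × (Fin n → ℝ) |
        ∀ j, A.mulVec C j = 0 → A.mulVec p.2 j ≤ b j} := by
      simp only [Set.ofPred_forall]
      exact MeasurableSet.iInter fun j => MeasurableSet.iInter fun _ =>
        measurableSet_le ((measurable_mulVec_apply A j).comp measurable_snd) measurable_const
    exact h0.inter ((measurableSet_le hVm hcoe).inter (measurableSet_le hcoe hVp))
  have hR : MeasurableSet R := by
    have hx : Measurable fun p : ℝ × (Fin n → ℝ) => stdNormalCDF ((p.1 - 0) / √v) :=
      continuous_stdNormalCDF.measurable.comp ((measurable_fst.sub_const _).div_const _)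
    have hm := (measurable_stdNormalCDFAff 0 (√v)).comp hVm
    have hp := (measurable_stdNormalCDFAff 0 (√v)).comp hVp
    exact measurableSet_le (((hx.sub hm).div (hp.sub hm)).const_sub 1) measurable_const
  have hSpre : {ω | ∀ j, A.mulVec (Y ω) j ≤ b j} = (fun ω => (η ⬝ᵥ Y ω, Z ω)) ⁻¹' S := by
    ext ω
    have hYω : Y ω = Z ω + (η ⬝ᵥ Y ω) • C := by simp [hZ']
    have := mulVec_add_smul_le_iff A b C (Z ω) (η ⬝ᵥ Y ω)
    rw [← hYω] at this
    exact this
  have hRpre : {ω | T ω ≤ α} = (fun ω => (η ⬝ᵥ Y ω, Z ω)) ⁻¹' R := by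
    ext ω
    simp [R, hT]
  have hkey : (gaussianReal 0 v.toNNReal).prod (P.map Z) (S ∩ R) =
      ENNReal.ofReal α * (gaussianReal 0 v.toNNReal).prod (P.map Z) S := by
    rw [Measure.prod_apply_symm (hS.inter hR), Measure.prod_apply_symm hS,
      ← lintegral_const_mul _ (measurable_measure_prodMk_right hS)]
    refine lintegral_congr fun z => ?_
    by_cases hz : ∀ j, A.mulVec C j = 0 → A.mulVec z j ≤ b j
    · have := gaussianReal_one_sub_truncGaussCDF_le hv (Vminus A b C z) (Vplus A b C z) hα
      convert this using 3
      · ext x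
        exact ⟨fun h => ⟨h.1.2, h.2⟩, fun h => ⟨⟨hz, h.1⟩, h.2⟩⟩
      · ext x
        exact ⟨fun h => h.2, fun h => ⟨hz, h⟩⟩
    · have hempty : (fun x : ℝ => (x, z)) ⁻¹' S = ∅ := Set.eq_empty_of_forall_notMem
        fun x hx => hz hx.1
      rw [Set.preimage_inter, hempty]
      simp
  have hpm := hXm.prodMk hZm
  rw [hSpre] at hsel ⊢
  rw [hRpre, cond_apply (hpm hS), ← Set.preimage_inter, ← Measure.map_apply hpm (hS.inter hR),
    hjoint, hkey, ← hjoint, Measure.map_apply hpm hS, mul_left_comm,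
    ENNReal.inv_mul_cancel hsel.ne' (measure_ne_top _ _), mul_one]
end
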